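/- Let M = !![α, β; γ, δ] be a 2×2 matrix over the Gaussian integers ℤ[i] with determinant αδ − βγ = 1 and γ ≠ 0, and let θ ∈ ℤ[i] satisfy 2·N(θ·γ + δ) ≤ N(γ). Define M' := !![θ·α + β, −α; θ·γ + δ, −γ]. Then ‖M'‖ ≤ ‖M‖. -/

import Mathlib

open Matrix

/-- The norm of a `2 × 2` matrix over the Gaussian integers: the maximum of the
field norms of its four entries. -/
def matNormGauss (M : Matrix (Fin 2) (Fin 2) GaussianInt) : ℤ :=
  max (max (Zsqrtd.norm (M 0 0)) (Zsqrtd.norm (M 0 1)))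
      (max (Zsqrtd.norm (M 1 0)) (Zsqrtd.norm (M 1 1)))

theorem GaussianInt.norm_sub_one (z : GaussianInt) :
    Zsqrtd.norm (z - 1) = Zsqrtd.norm z - 2 * z.re + 1 := by
  simp only [Zsqrtd.norm_def, Zsqrtd.re_sub, Zsqrtd.im_sub, Zsqrtd.re_one, Zsqrtd.im_one]
  ring

theorem GaussianInt.re_sq_le_norm (z : GaussianInt) : z.re ^ 2 ≤ Zsqrtd.norm z := by
  simp only [Zsqrtd.norm_def]
  nlinarith [mul_self_nonneg z.im]

/-- If `a * d - b * c = 1` in the Gaussian integers, `c ≠ 0` and `d` is at most half as large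
as `c` in norm, then the norm of `b` is at most that of `a` or that of `c`. -/
theorem GaussianInt.norm_le_max_of_det_eq_one {a b c d : GaussianInt}
    (hdet : a * d - b * c = 1) (hc : c ≠ 0)
    (hd : 2 * Zsqrtd.norm d ≤ Zsqrtd.norm c) :
    Zsqrtd.norm b ≤ max (Zsqrtd.norm a) (Zsqrtd.norm c) := by
  have hbc : b * c = a * d - 1 := by linear_combination -hdet
  have hnorm := congrArg Zsqrtd.norm hbc
  rw [GaussianInt.norm_sub_one, Zsqrtd.norm_mul, Zsqrtd.norm_mul] at hnorm
  have hre := GaussianInt.re_sq_le_norm (a * d)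
  rw [Zsqrtd.norm_mul] at hre
  have hA : 0 ≤ Zsqrtd.norm a := GaussianInt.norm_nonneg a
  have hD : 0 ≤ Zsqrtd.norm d := GaussianInt.norm_nonneg d
  have hG : 0 < Zsqrtd.norm c := GaussianInt.norm_pos.2 hc
  generalize (a * d).re = t at *
  generalize Zsqrtd.norm a = A at *
  generalize Zsqrtd.norm b = B at *
  generalize Zsqrtd.norm c = G at *
  generalize Zsqrtd.norm d = D at *
  by_contra! hlt
  obtain ⟨hBA, hBG⟩ := max_lt_iff.1 hlt
  rcases hD.eq_or_lt with rfl | hD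
  · have ht : t = 0 := by nlinarith
    subst ht
    nlinarith
  · have hlower : 2 * D * (A + 1) ≤ B * G := by
      rw [mul_comm B G]
      exact mul_le_mul hd hBA (by positivity) hG.le
    have hsq : (t + 1) ^ 2 ≤ 0 := by nlinarith
    have ht : t = -1 := by
      linarith [pow_eq_zero_iff two_ne_zero |>.1 (le_antisymm hsq (sq_nonneg (t + 1)))]
    subst ht
    nlinarith

theorem stmt_6 (α β γ δ θ : GaussianInt)
    (hdet : α * δ - β * γ = 1) (hγ : γ ≠ 0)
    (hθ : 2 * Zsqrtd.norm (θ * γ + δ) ≤ Zsqrtd.norm γ) :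
    matNormGauss !![θ * α + β, -α; θ * γ + δ, -γ] ≤ matNormGauss !![α, β; γ, δ] := by
  have hdet' : α * (θ * γ + δ) - (θ * α + β) * γ = 1 := by linear_combination hdet
  have hmax := GaussianInt.norm_le_max_of_det_eq_one hdet' hγ hθ
  have hnonneg : 0 ≤ Zsqrtd.norm (θ * γ + δ) := GaussianInt.norm_nonneg _
  simp only [matNormGauss, Matrix.of_apply, Matrix.cons_val', Matrix.cons_val_zero,
    Matrix.cons_val_one, Matrix.cons_val_fin_one, Zsqrtd.norm_neg]
  omega
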